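/- For every r>0 and every c∈(0,1) there exist E>0, γ>0 and h₀>0 (depending on r and c) such that for all z∈ℂ with Re z<−E and |Im z|<γ and all h∈(0,h₀) one has |∫₀^∞ e^{zt} p_h(r,t) dt| ≥ ((1−c)/(2π)) · (π²/(4·(−Re z)·r²))^{1/4} · exp(−√(−Re z)·r). (This is a lower bound for the modulus of the Green function of the Landau Hamiltonian at distance r, uniform for weak magnetic fields and in a tube around the very negative real axis.) -/

import Mathlib

open MeasureTheory Real Set

/-- Modulus of the Landau heat kernel at distance `r`. -/
noncomputable def landauHeatKernel (h r t : ℝ) : ℝ :=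
  h / (4 * π * Real.sinh (h * t)) *
    Real.exp (-(h * r ^ 2 * (Real.cosh (h * t) / Real.sinh (h * t))) / 4)

lemma sinh_le_mul_exp {x : ℝ} : sinh x ≤ x * exp x := by
  rw [sinh_eq]
  have h1 : -(2 * x) + 1 ≤ exp (-(2 * x)) := add_one_le_exp _
  have h2 : exp (-x) = exp (-(2 * x)) * exp x := by rw [← exp_add]; ring_nf
  rw [h2]
  nlinarith [exp_pos x]

lemma sinh_le_mul_cosh {x : ℝ} (hx : 0 ≤ x) : sinh x ≤ x * cosh x := by
  have hder : MonotoneOn (fun y : ℝ => y * cosh y - sinh y) (Ici 0) := by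
    refine monotoneOn_of_hasDerivWithinAt_nonneg (convex_Ici 0) (by fun_prop)
      (f' := fun y => y * sinh y) ?_ ?_
    · intro y _
      have := ((hasDerivAt_id y).mul (hasDerivAt_cosh y)).sub (hasDerivAt_sinh y)
      refine (this.congr_deriv ?_).hasDerivWithinAt
      simp
    · intro y hy
      rw [interior_Ici] at hy
      exact mul_nonneg (le_of_lt hy) (sinh_nonneg_iff.2 (le_of_lt hy))
  have := hder (self_mem_Ici) (mem_Ici.2 hx) hx
  simp at this
  linarith

lemma mul_cosh_le {x : ℝ} (hx : 0 ≤ x) : x * cosh x ≤ (1 + x ^ 2) * sinh x := by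
  have hder : MonotoneOn (fun y : ℝ => (1 + y ^ 2) * sinh y - y * cosh y) (Ici 0) := by
    refine monotoneOn_of_hasDerivWithinAt_nonneg (convex_Ici 0) (by fun_prop)
      (f' := fun y => y * sinh y + y ^ 2 * cosh y) ?_ ?_
    · intro y _
      have := ((((hasDerivAt_id y).pow 2).const_add 1).mul (hasDerivAt_sinh y)).sub
        ((hasDerivAt_id y).mul (hasDerivAt_cosh y))
      refine (this.congr_deriv ?_).hasDerivWithinAt
      simp
      ring
    · intro y hy
      rw [interior_Ici] at hy
      have hy' : 0 ≤ y := le_of_lt hy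
      have := sinh_nonneg_iff.2 hy'
      have := cosh_pos y
      positivity
  have := hder (self_mem_Ici) (mem_Ici.2 hx) hx
  simp at this
  linarith

/-- Heat kernel of the free Laplacian on the plane at distance `r`. -/
noncomputable def freeHeatKernel (r t : ℝ) : ℝ :=
  1 / (4 * π * t) * exp (-(r ^ 2 / (4 * t)))

lemma landauHeatKernel_nonneg {h r t : ℝ} (hh : 0 < h) (ht : 0 < t) :
    0 ≤ landauHeatKernel h r t := by
  have := sinh_pos_iff.2 (mul_pos hh ht)
  unfold landauHeatKernel
  positivity

lemma landauHeatKernel_le_freeHeatKernel {h r t : ℝ} (hh : 0 < h) (ht : 0 < t) :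
    landauHeatKernel h r t ≤ freeHeatKernel r t := by
  have hx := mul_pos hh ht
  have hs := sinh_pos_iff.2 hx
  unfold landauHeatKernel freeHeatKernel
  apply mul_le_mul
  · rw [div_le_div_iff₀ (by positivity) (by positivity)]
    nlinarith [mul_le_mul_of_nonneg_left (self_le_sinh_iff.2 hx.le) pi_pos.le]
  · apply exp_le_exp.2
    have h1 : 1 / t ≤ h * (cosh (h * t) / sinh (h * t)) := by
      rw [← mul_div_assoc, div_le_div_iff₀ ht hs]
      linarith [sinh_le_mul_cosh hx.le]
    have h2 := mul_le_mul_of_nonneg_left h1 (sq_nonneg r)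
    have h3 : r ^ 2 / (4 * t) = r ^ 2 * (1 / t) / 4 := by field_simp
    rw [h3]
    linarith
  · positivity
  · positivity

lemma freeHeatKernel_mul_le_landauHeatKernel {h r t : ℝ} (hh : 0 < h) (ht : 0 < t) :
    freeHeatKernel r t * (1 - (h + r ^ 2 * h ^ 2 / 4) * t) ≤ landauHeatKernel h r t := by
  have hx := mul_pos hh ht
  have hs := sinh_pos_iff.2 hx
  have hexp : 1 - (h + r ^ 2 * h ^ 2 / 4) * t ≤ exp (-(h * t)) * exp (-(r ^ 2 * h ^ 2 / 4 * t)) := by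
    rw [← exp_add]
    linarith [add_one_le_exp (-(h * t) + -(r ^ 2 * h ^ 2 / 4 * t))]
  have hfree : 0 ≤ freeHeatKernel r t := by unfold freeHeatKernel; positivity
  refine (mul_le_mul_of_nonneg_left hexp hfree).trans ?_
  unfold landauHeatKernel freeHeatKernel
  rw [mul_mul_mul_comm]
  apply mul_le_mul
  · rw [div_mul_eq_mul_div, div_le_div_iff₀ (by positivity) (by positivity), exp_neg]
    have h1 : (exp (h * t))⁻¹ * sinh (h * t) ≤ h * t := by
      rw [inv_mul_le_iff₀ (exp_pos _)]
      linarith [sinh_le_mul_exp (x := h * t)]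
    nlinarith [mul_le_mul_of_nonneg_left h1 pi_pos.le]
  · rw [← exp_add]
    apply exp_le_exp.2
    have h1 : h * (cosh (h * t) / sinh (h * t)) ≤ 1 / t + h ^ 2 * t := by
      rw [← mul_div_assoc, div_add' _ _ _ ht.ne', div_le_div_iff₀ hs ht]
      linarith [mul_cosh_le hx.le]
    have h2 := mul_le_mul_of_nonneg_left h1 (sq_nonneg r)
    have h3 : r ^ 2 / (4 * t) = r ^ 2 * (1 / t) / 4 := by field_simp
    rw [h3]
    linarith
  · positivity
  · positivity

lemma le_cos_mul_landauHeatKernel {h r t : ℝ} (y : ℝ) (hh : 0 < h) (ht : 0 < t) :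
    freeHeatKernel r t * (1 - (|y| + h + r ^ 2 * h ^ 2 / 4) * t) ≤
      cos (y * t) * landauHeatKernel h r t := by
  have hcos : 1 - |y| * t ≤ cos (y * t) := by
    have := (abs_le.1 (abs_cos_sub_cos_le (y * t) 0)).1
    rw [cos_zero, sub_zero, abs_mul, abs_of_pos ht] at this
    linarith
  have h1 := mul_le_mul_of_nonneg_right hcos (landauHeatKernel_nonneg (r := r) hh ht)
  have h2 := freeHeatKernel_mul_le_landauHeatKernel (r := r) hh ht
  have h3 := mul_le_mul_of_nonneg_left (landauHeatKernel_le_freeHeatKernel (r := r) hh ht)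
    (mul_nonneg (abs_nonneg y) ht.le)
  linarith

lemma measurable_landauHeatKernel (h r : ℝ) : Measurable (landauHeatKernel h r) := by
  unfold landauHeatKernel
  fun_prop

/-- The substitution turning the phase `k² t + r² / (4 t)` into `k r (1 + 2 x²)`. -/
noncomputable def saddleParam (r k x : ℝ) : ℝ :=
  r / (2 * k) * exp (2 * arsinh x)

lemma saddleParam_pos {r k : ℝ} (hr : 0 < r) (hk : 0 < k) (x : ℝ) : 0 < saddleParam r k x := by
  unfold saddleParam
  positivity

lemma measurable_saddleParam (r k : ℝ) : Measurable (saddleParam r k) := by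
  have : Measurable arsinh := continuous_arsinh.measurable
  unfold saddleParam
  fun_prop

lemma hasDerivAt_saddleParam (r k x : ℝ) :
    HasDerivAt (saddleParam r k) (2 * saddleParam r k x / √(1 + x ^ 2)) x := by
  have := (((hasDerivAt_arsinh x).const_mul 2).exp).const_mul (r / (2 * k))
  refine this.congr_deriv ?_
  unfold saddleParam
  ring

lemma saddleParam_injective {r k : ℝ} (hr : 0 < r) (hk : 0 < k) :
    Function.Injective (saddleParam r k) := by
  intro x y hxy
  unfold saddleParam at hxy
  have h1 := mul_left_cancel₀ (by positivity : r / (2 * k) ≠ 0) hxy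
  exact arsinh_injective (mul_left_cancel₀ two_ne_zero (exp_injective h1))

lemma range_saddleParam {r k : ℝ} (hr : 0 < r) (hk : 0 < k) :
    range (saddleParam r k) = Ioi 0 := by
  ext t
  constructor
  · rintro ⟨x, rfl⟩
    exact saddleParam_pos hr hk x
  · intro ht
    refine ⟨sinh (log (t / (r / (2 * k))) / 2), ?_⟩
    have ht' : 0 < t / (r / (2 * k)) := div_pos ht (by positivity)
    unfold saddleParam
    rw [arsinh_sinh, mul_div_cancel₀ _ two_ne_zero, exp_log ht']
    field_simp

lemma saddleParam_phase {r k : ℝ} (hr : 0 < r) (hk : 0 < k) (x : ℝ) :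
    k ^ 2 * saddleParam r k x + r ^ 2 / (4 * saddleParam r k x) = k * r * (1 + 2 * x ^ 2) := by
  have h1 : 1 + 2 * x ^ 2 = cosh (2 * arsinh x) := by
    rw [cosh_two_mul, cosh_sq', sinh_arsinh]; ring
  rw [h1, cosh_eq, exp_neg]
  unfold saddleParam
  field_simp
  ring

lemma saddleParam_le {r k : ℝ} (hr : 0 < r) (hk : 0 < k) (x : ℝ) :
    saddleParam r k x ≤ r / k * (1 + 2 * x ^ 2) := by
  have h1 : 1 + 2 * x ^ 2 = cosh (2 * arsinh x) := by
    rw [cosh_two_mul, cosh_sq', sinh_arsinh]; ring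
  rw [h1, cosh_eq]
  have h2 : saddleParam r k x = r / k * (exp (2 * arsinh x) / 2) := by
    unfold saddleParam; field_simp
  rw [h2]
  gcongr
  linarith [exp_pos (-(2 * arsinh x))]

lemma integral_Ioi_eq_integral_saddleParam {r k : ℝ} (hr : 0 < r) (hk : 0 < k) (g : ℝ → ℂ) :
    ∫ t in Ioi (0 : ℝ), g t =
      ∫ x, (2 * saddleParam r k x / √(1 + x ^ 2)) • g (saddleParam r k x) := by
  rw [← range_saddleParam hr hk, ← image_univ,
    integral_image_eq_integral_abs_deriv_smul MeasurableSet.univ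
      (fun x _ => (hasDerivAt_saddleParam r k x).hasDerivWithinAt)
      (saddleParam_injective hr hk).injOn, setIntegral_univ]
  congr 1 with x
  have := saddleParam_pos hr hk x
  rw [abs_of_nonneg (by positivity)]

lemma saddleParam_weight {r k : ℝ} (hr : 0 < r) (hk : 0 < k) (x : ℝ) :
    2 * saddleParam r k x / √(1 + x ^ 2) *
        (exp (-k ^ 2 * saddleParam r k x) * freeHeatKernel r (saddleParam r k x)) =
      exp (-(k * r)) / (2 * π) * exp (-(2 * (k * r)) * x ^ 2) * (1 / √(1 + x ^ 2)) := by
  have hpos := saddleParam_pos hr hk x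
  have hphase := saddleParam_phase hr hk x
  have hsq : 0 < √(1 + x ^ 2) := by positivity
  have h1 : exp (-k ^ 2 * saddleParam r k x) * exp (-(r ^ 2 / (4 * saddleParam r k x))) =
      exp (-(k * r)) * exp (-(2 * (k * r)) * x ^ 2) := by
    rw [← exp_add, ← exp_add]
    congr 1
    linarith
  unfold freeHeatKernel
  rw [mul_left_comm (exp _), h1]
  field_simp
  norm_num

lemma one_sub_half_sq_le_inv_sqrt (x : ℝ) : 1 - x ^ 2 / 2 ≤ 1 / √(1 + x ^ 2) := by
  have hsq : 0 < √(1 + x ^ 2) := by positivity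
  have h1 : √(1 + x ^ 2) ≤ 1 + x ^ 2 / 2 := by
    rw [sqrt_le_left (by positivity)]
    nlinarith [sq_nonneg (x ^ 2)]
  rw [le_div_iff₀ hsq]
  rcases le_or_gt (1 - x ^ 2 / 2) 0 with h | h
  · nlinarith
  · nlinarith [sq_nonneg (x ^ 2)]

lemma inv_sqrt_le_one (x : ℝ) : 1 / √(1 + x ^ 2) ≤ 1 := by
  have h1 : 1 ≤ √(1 + x ^ 2) := one_le_sqrt.2 (by nlinarith [sq_nonneg x])
  exact div_le_one_of_le₀ h1 (by positivity)

lemma gaussian_mul_sub_ge {a A B : ℝ} (ha : 0 < a) (hB : 0 ≤ B) (x : ℝ) :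
    (1 - A) * exp (-(2 * a) * x ^ 2) - B / a * exp (-a * x ^ 2) ≤
      exp (-(2 * a) * x ^ 2) * (1 - A - B * x ^ 2) := by
  have h1 : a * x ^ 2 ≤ exp (a * x ^ 2) := by linarith [add_one_le_exp (a * x ^ 2)]
  have h2 : exp (-a * x ^ 2) = exp (a * x ^ 2) * exp (-(2 * a) * x ^ 2) := by
    rw [← exp_add]; ring_nf
  have h3 : B * x ^ 2 ≤ B / a * exp (a * x ^ 2) := by
    rw [div_mul_eq_mul_div, le_div_iff₀ ha]
    nlinarith [mul_le_mul_of_nonneg_left h1 hB]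
  rw [h2]
  nlinarith [mul_le_mul_of_nonneg_right h3 (exp_pos (-(2 * a) * x ^ 2)).le]

lemma integrable_gaussian_sub {a A B : ℝ} (ha : 0 < a) :
    Integrable fun x : ℝ => (1 - A) * exp (-(2 * a) * x ^ 2) - B / a * exp (-a * x ^ 2) :=
  ((integrable_exp_neg_mul_sq (by positivity : 0 < 2 * a)).const_mul _).sub
    ((integrable_exp_neg_mul_sq ha).const_mul _)

lemma le_integral_gaussian_sub {a A B : ℝ} (ha : 0 < a) (hB : 0 ≤ B) :
    (1 - A - 2 * B / a) * √(π / (2 * a)) ≤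
      ∫ x : ℝ, ((1 - A) * exp (-(2 * a) * x ^ 2) - B / a * exp (-a * x ^ 2)) := by
  rw [integral_sub ((integrable_exp_neg_mul_sq (by positivity : 0 < 2 * a)).const_mul _)
    ((integrable_exp_neg_mul_sq ha).const_mul _), integral_const_mul, integral_const_mul,
    integral_gaussian, integral_gaussian]
  have h1 : √(π / a) ≤ 2 * √(π / (2 * a)) := by
    rw [sqrt_le_left (by positivity), mul_pow, sq_sqrt (by positivity)]
    have : π / (2 * a) = π / a / 2 := by field_simp
    rw [this]
    nlinarith [div_pos pi_pos ha]
  have h2 := mul_le_mul_of_nonneg_left h1 (div_nonneg hB ha.le)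
  have h3 : 2 * B / a = 2 * (B / a) := by ring
  rw [h3]
  linarith

lemma norm_cexp_mul_landauHeatKernel {h r t : ℝ} (z : ℂ) (hh : 0 < h) (ht : 0 < t) :
    ‖Complex.exp (z * t) * ((landauHeatKernel h r t : ℝ) : ℂ)‖ =
      exp (z.re * t) * landauHeatKernel h r t := by
  rw [norm_mul, Complex.norm_exp, Complex.norm_real,
    norm_of_nonneg (landauHeatKernel_nonneg hh ht)]
  simp

lemma re_cexp_mul_landauHeatKernel (h r t : ℝ) (z : ℂ) :
    (Complex.exp (z * t) * ((landauHeatKernel h r t : ℝ) : ℂ)).re =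
      exp (z.re * t) * (cos (z.im * t) * landauHeatKernel h r t) := by
  rw [Complex.re_mul_ofReal, Complex.exp_re]
  simp
  ring

lemma le_norm_integral_landauHeatKernel {h r k M : ℝ} {z : ℂ} (hh : 0 < h) (hr : 0 < r)
    (hk : 0 < k) (hz : z.re = -k ^ 2) (hM : |z.im| + h + r ^ 2 * h ^ 2 / 4 ≤ M) :
    exp (-(k * r)) / (2 * π) *
        ((1 - M * (r / k) - 2 * (1 / 2 + 2 * M * (r / k)) / (k * r)) * √(π / (2 * (k * r)))) ≤
      ‖∫ t in Ioi (0 : ℝ), Complex.exp (z * t) * ((landauHeatKernel h r t : ℝ) : ℂ)‖ := by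
  have ha : 0 < k * r := by positivity
  have hM0 : 0 ≤ M := le_trans (by positivity) hM
  set G : ℝ → ℂ := fun t => Complex.exp (z * t) * ((landauHeatKernel h r t : ℝ) : ℂ) with hG
  set F : ℝ → ℂ := fun x =>
    (2 * saddleParam r k x / √(1 + x ^ 2)) • G (saddleParam r k x) with hF
  have hweight : ∀ x, 0 < 2 * saddleParam r k x / √(1 + x ^ 2) := fun x => by
    have := saddleParam_pos hr hk x
    positivity
  have hFint : Integrable F := by
    refine Integrable.mono' (g := fun x =>
      exp (-(k * r)) / (2 * π) * exp (-(2 * (k * r)) * x ^ 2))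
      ((integrable_exp_neg_mul_sq (by positivity)).const_mul _) ?_ ?_
    · have h1 := measurable_saddleParam r k
      have h3 : Measurable G := by
        have := measurable_landauHeatKernel h r
        fun_prop
      have h4 : Measurable F := by
        have hw : Measurable fun x => 2 * saddleParam r k x / √(1 + x ^ 2) := by fun_prop
        exact hw.smul (h3.comp h1)
      exact h4.aestronglyMeasurable
    · refine Filter.Eventually.of_forall fun x => ?_
      have hpos := saddleParam_pos hr hk x
      rw [hF, hG]
      simp only
      rw [norm_smul, norm_of_nonneg (hweight x).le, norm_cexp_mul_landauHeatKernel z hh hpos, hz]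
      calc _ ≤ 2 * saddleParam r k x / √(1 + x ^ 2) *
            (exp (-k ^ 2 * saddleParam r k x) * freeHeatKernel r (saddleParam r k x)) := by
            have := landauHeatKernel_le_freeHeatKernel (r := r) hh hpos
            have := hweight x
            gcongr
        _ ≤ _ := by
            rw [saddleParam_weight hr hk x]
            exact mul_le_of_le_one_right (by positivity) (inv_sqrt_le_one x)
  have hFre : ∀ x, exp (-(k * r)) / (2 * π) *
      ((1 - M * (r / k)) * exp (-(2 * (k * r)) * x ^ 2) -
        (1 / 2 + 2 * M * (r / k)) / (k * r) * exp (-(k * r) * x ^ 2)) ≤ (F x).re := by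
    intro x
    have hpos := saddleParam_pos hr hk x
    have hre : (F x).re = 2 * saddleParam r k x / √(1 + x ^ 2) *
        (exp (-k ^ 2 * saddleParam r k x) *
          (cos (z.im * saddleParam r k x) * landauHeatKernel h r (saddleParam r k x))) := by
      rw [hF, hG]
      simp only
      rw [Complex.smul_re, smul_eq_mul, re_cexp_mul_landauHeatKernel, hz]
    have hfree : 0 ≤ freeHeatKernel r (saddleParam r k x) := by
      unfold freeHeatKernel; positivity
    have hcos : freeHeatKernel r (saddleParam r k x) * (1 - M * saddleParam r k x) ≤
        cos (z.im * saddleParam r k x) * landauHeatKernel h r (saddleParam r k x) := by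
      refine le_trans ?_ (le_cos_mul_landauHeatKernel z.im hh hpos)
      gcongr
    have hinv : 1 - M * (r / k) - (1 / 2 + 2 * M * (r / k)) * x ^ 2 ≤
        1 / √(1 + x ^ 2) * (1 - M * saddleParam r k x) := by
      have h1 := mul_le_mul_of_nonneg_left (saddleParam_le hr hk x) hM0
      have h2 := mul_le_mul_of_nonneg_right (inv_sqrt_le_one x) (mul_nonneg hM0 hpos.le)
      linarith [one_sub_half_sq_le_inv_sqrt x]
    rw [hre]
    calc _ ≤ exp (-(k * r)) / (2 * π) * (exp (-(2 * (k * r)) * x ^ 2) *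
          (1 - M * (r / k) - (1 / 2 + 2 * M * (r / k)) * x ^ 2)) := by
          gcongr
          exact gaussian_mul_sub_ge ha (by positivity) x
      _ ≤ exp (-(k * r)) / (2 * π) * (exp (-(2 * (k * r)) * x ^ 2) *
          (1 / √(1 + x ^ 2) * (1 - M * saddleParam r k x))) := by gcongr
      _ = 2 * saddleParam r k x / √(1 + x ^ 2) *
          (exp (-k ^ 2 * saddleParam r k x) * freeHeatKernel r (saddleParam r k x)) *
          (1 - M * saddleParam r k x) := by
          rw [saddleParam_weight hr hk x]; ring
      _ = 2 * saddleParam r k x / √(1 + x ^ 2) * (exp (-k ^ 2 * saddleParam r k x) *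
          (freeHeatKernel r (saddleParam r k x) * (1 - M * saddleParam r k x))) := by ring
      _ ≤ _ := by
          have := hweight x
          gcongr
  rw [integral_Ioi_eq_integral_saddleParam hr hk]
  calc _ ≤ exp (-(k * r)) / (2 * π) * ∫ x : ℝ,
        ((1 - M * (r / k)) * exp (-(2 * (k * r)) * x ^ 2) -
          (1 / 2 + 2 * M * (r / k)) / (k * r) * exp (-(k * r) * x ^ 2)) := by
        gcongr
        exact le_integral_gaussian_sub ha (by positivity)
    _ ≤ ∫ x, (F x).re := by
        rw [← integral_const_mul]
        exact integral_mono ((integrable_gaussian_sub ha).const_mul _) hFint.re hFre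
    _ = (∫ x, F x).re := integral_re hFint
    _ ≤ ‖∫ x, F x‖ := Complex.re_le_norm _

lemma rpow_quarter_eq_sqrt {a : ℝ} (ha : 0 < a) :
    (π ^ 2 / (4 * a ^ 2)) ^ ((1 : ℝ) / 4) = √(π / (2 * a)) := by
  have h1 : π ^ 2 / (4 * a ^ 2) = (π / (2 * a)) ^ (2 : ℝ) := by
    rw [rpow_two]; field_simp; norm_num
  rw [h1, ← rpow_mul (by positivity), sqrt_eq_rpow]
  norm_num

/-- Lower bound for the modulus of the Green function of the Landau Hamiltonian at
distance `r`, uniform for weak magnetic fields and in a tube around the very negative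
real axis: for every `r>0` and `c∈(0,1)` there exist `E,γ,h₀>0` such that for
`Re z<−E`, `|Im z|<γ` and `h∈(0,h₀)`,
`|∫₀^∞ e^{zt} p_h(r,t) dt| ≥ ((1−c)/(2π)) (π²/(4(−Re z) r²))^{1/4} e^{−√(−Re z) r}`. -/
theorem landau_green_lower_bound_tube (r c : ℝ) (hr : 0 < r) (hc : c ∈ Ioo (0 : ℝ) 1) :
    ∃ E > 0, ∃ γ > 0, ∃ h₀ > 0, ∀ (h : ℝ) (z : ℂ),
      h ∈ Ioo (0 : ℝ) h₀ → z.re < -E → |z.im| < γ →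
      ((1 - c) / (2 * π)) * (π ^ 2 / (4 * (-z.re) * r ^ 2)) ^ ((1 : ℝ) / 4) *
          Real.exp (-Real.sqrt (-z.re) * r) ≤
        ‖∫ t in Ioi (0 : ℝ), Complex.exp (z * t) * ((landauHeatKernel h r t : ℝ) : ℂ)‖ := by
  obtain ⟨hc0, -⟩ := hc
  set M : ℝ := 2 + r ^ 2 / 4 with hM
  have hMpos : 0 < M := by positivity
  set N : ℝ := M * r + 1 / r + 4 * M with hN
  have hNpos : 0 < N := by positivity
  refine ⟨(1 + N / c) ^ 2, by positivity, 1, one_pos, 1, one_pos, ?_⟩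
  rintro h z ⟨hh0, hh1⟩ hzre hzim
  set k : ℝ := √(-z.re) with hkdef
  have hk1 : 1 + N / c < k := lt_sqrt_of_sq_lt (by linarith)
  have hNc : 0 < N / c := by positivity
  have hk : 0 < k := by linarith
  have hksq : k ^ 2 = -z.re := sq_sqrt (by nlinarith)
  have hbound : |z.im| + h + r ^ 2 * h ^ 2 / 4 ≤ M := by
    have : r ^ 2 * h ^ 2 ≤ r ^ 2 * 1 := by
      gcongr
      exact pow_le_one₀ hh0.le hh1.le
    linarith
  refine le_trans ?_ (le_norm_integral_landauHeatKernel hh0 hr hk (by linarith) hbound)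
  have herr : M * (r / k) + 2 * (1 / 2 + 2 * M * (r / k)) / (k * r) ≤ c := by
    have h1 : M * (r / k) + 2 * (1 / 2 + 2 * M * (r / k)) / (k * r) =
        (M * r + 1 / r + 4 * M / k) / k := by
      field_simp
      ring
    rw [h1, div_le_iff₀ hk]
    have h2 : 4 * M / k ≤ 4 * M := div_le_self (by positivity) (by linarith)
    have h3 : N < c * k := by
      rw [← div_lt_iff₀' hc0]
      linarith
    linarith
  have hbase : 4 * (-z.re) * r ^ 2 = 4 * (k * r) ^ 2 := by rw [← hksq]; ring
  rw [hbase, rpow_quarter_eq_sqrt (by positivity)]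
  calc _ = exp (-(k * r)) / (2 * π) * ((1 - c) * √(π / (2 * (k * r)))) := by
        rw [neg_mul]; ring
    _ ≤ _ := by
        refine mul_le_mul_of_nonneg_left (mul_le_mul_of_nonneg_right ?_ (sqrt_nonneg _))
          (by positivity)
        linarith
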